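/- Let S = {l₁, …, l₈} be eight distinct lines in Pic S₈ pairwise intersecting in 1 (an A₇⁸(1)-polytope) with center D = l₁ + ⋯ + l₈. Then: (a) the class f determined by 2f = D + 4K is a ruling (f·f = 0, f·K = −2); (b) if a 4-element subset of S forms a cornered A₃⁸(1)-polytope with center D₁, then its complement in S also forms a cornered A₃⁸(1)-polytope with center D₂ = D − D₁, and the associated lines K + D₁/2 and K + D₂/2 have intersection 1 and sum f; (c) there are exactly seven such unordered partitions of S into two complementary cornered 4-element subsets. -/

import Mathlib

/-!
Picard lattice of the degree 1 del Pezzo surface S₈: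
Pic S₈ = ℤh ⊕ ℤe₁ ⊕ ⋯ ⊕ ℤe₈ ≅ ℤ⁹, with intersection pairing
h·h = 1, h·eᵢ = 0, eᵢ·eⱼ = −δᵢⱼ, and canonical class K = −3h + e₁ + ⋯ + e₈.
-/

namespace DelPezzo

/-- The Picard lattice `Pic S₈ ≅ ℤ⁹`; coordinate `0` is the `h`-coordinate and
coordinates `1,…,8` are the `e₁,…,e₈`-coordinates. -/
abbrev Pic : Type := Fin 9 → ℤ

/-- The intersection pairing on `Pic S₈` (signature `(1,-8)`). -/
def inter (x y : Pic) : ℤ := x 0 * y 0 - ∑ i : Fin 8, x i.succ * y i.succ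

/-- The canonical class `K = -3h + e₁ + ⋯ + e₈`. -/
def K : Pic := fun i => if i = 0 then -3 else 1

/-- A line: a class `l` with `l·l = -1` and `l·K = -1`. -/
def IsLine (l : Pic) : Prop := inter l l = -1 ∧ inter l K = -1

/-- A finite set of lines is cornered if some line has intersection `0` with all of them. -/
def IsCornered (T : Finset Pic) : Prop := ∃ m : Pic, IsLine m ∧ ∀ x ∈ T, inter m x = 0

lemma inter_comm (x y : Pic) : inter x y = inter y x := by
  simp [inter, mul_comm]

lemma inter_add_left (x y z : Pic) : inter (x + y) z = inter x z + inter y z := by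
  simp only [inter, Pi.add_apply, add_mul, Finset.sum_add_distrib]
  ring

lemma inter_smul_left (n : ℤ) (x y : Pic) : inter (n • x) y = n * inter x y := by
  simp only [inter, Pi.smul_apply, smul_eq_mul, mul_assoc, ← Finset.mul_sum]
  ring

/-- The intersection pairing as a bilinear form. -/
def interForm : LinearMap.BilinForm ℤ Pic :=
  LinearMap.mk₂ ℤ inter inter_add_left inter_smul_left
    (fun x y z => by simp only [inter_comm x, inter_add_left])
    (fun n x y => by simp only [inter_comm x, inter_smul_left, smul_eq_mul])

lemma inter_eq_interForm (x y : Pic) : inter x y = interForm x y := rfl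

lemma interForm_comm (x y : Pic) : interForm x y = interForm y x := inter_comm x y

lemma interForm_K_K : interForm K K = 1 := by
  rw [← inter_eq_interForm]
  decide

lemma intCast_inter (x y : Pic) :
    ((inter x y : ℤ) : ZMod 2) = (fun j => (x j : ZMod 2)) ⬝ᵥ fun j => (y j : ZMod 2) := by
  simp [inter, dotProduct, Fin.sum_univ_succ, CharTwo.sub_eq_add]

/-- The intersection pairing is definite on the orthogonal complement of `K`. -/
lemma eq_zero_of_inter_K_eq_zero {u : Pic} (hK : inter u K = 0) (hu : inter u u = 0) :
    u = 0 := by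
  simp only [inter, K, Fin.succ_ne_zero, if_true, if_false, mul_one] at hK hu
  have hcs := sq_sum_le_card_mul_sum_sq (s := Finset.univ) (f := fun i : Fin 8 => u i.succ)
  simp only [Finset.card_univ, Fintype.card_fin, pow_two] at hcs
  have h0 : u 0 = 0 := by
    have hs : ∑ i : Fin 8, u i.succ = -3 * u 0 := by linarith
    have hq : ∑ i : Fin 8, u i.succ * u i.succ = u 0 * u 0 := by linarith
    rw [hs, hq] at hcs
    push_cast at hcs
    nlinarith
  have hq : ∑ i : Fin 8, u i.succ * u i.succ = 0 := by simpa [h0] using hu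
  rw [Finset.sum_eq_zero_iff_of_nonneg fun i _ => mul_self_nonneg _] at hq
  funext j
  refine Fin.cases h0 (fun i => ?_) j
  simpa using hq i (Finset.mem_univ i)

/-- `K` is a characteristic vector. -/
lemma even_inter_self_of_inter_K {w : Pic} (h : inter w K = 0) : Even (inter w w) := by
  have h2 : ((inter w w : ℤ) : ZMod 2) = ((inter w K : ℤ) : ZMod 2) := by
    rw [intCast_inter, intCast_inter]
    refine Finset.sum_congr rfl fun j _ => ?_
    have hK : ((K j : ℤ) : ZMod 2) = 1 := by
      revert j
      decide
    simp only [hK]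
    generalize (w j : ZMod 2) = a
    revert a
    decide
  rw [h, Int.cast_zero, ZMod.intCast_zmod_eq_zero_iff_dvd] at h2
  exact even_iff_two_dvd.mpr (by exact_mod_cast h2)

/-- A family of pairwise orthogonal classes of square `-2` in the orthogonal complement of `K`. -/
structure IsRootFrame (v : Fin 8 → Pic) : Prop where
  inter_K : ∀ i, inter (v i) K = 0
  inter_inter : ∀ i j, inter (v i) (v j) = if i = j then -2 else 0

/-- Subsets of a root frame whose sum is divisible by two. -/
def IsHalvable (v : Fin 8 → Pic) (A : Finset (Fin 8)) : Prop :=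
  ∃ w : Pic, 2 • w = ∑ i ∈ A, v i

namespace IsRootFrame

variable {v : Fin 8 → Pic}

lemma inter_sum_K (hv : IsRootFrame v) (A : Finset (Fin 8)) : inter (∑ i ∈ A, v i) K = 0 := by
  simp only [inter_eq_interForm, map_sum, LinearMap.sum_apply]
  exact Finset.sum_eq_zero fun i _ => hv.inter_K i

lemma inter_sum_left (hv : IsRootFrame v) (A : Finset (Fin 8)) (j : Fin 8) :
    inter (∑ i ∈ A, v i) (v j) = if j ∈ A then -2 else 0 := by
  simp only [inter_eq_interForm, map_sum, LinearMap.sum_apply]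
  simp only [← inter_eq_interForm, hv.inter_inter, Finset.sum_ite_eq']

lemma inter_sum_sum (hv : IsRootFrame v) (A B : Finset (Fin 8)) :
    inter (∑ i ∈ A, v i) (∑ j ∈ B, v j) = -2 * (A ∩ B).card := by
  rw [inter_eq_interForm, map_sum]
  simp only [← inter_eq_interForm, hv.inter_sum_left, ← Finset.sum_filter, Finset.sum_const]
  rw [Finset.filter_mem_eq_inter, Finset.inter_comm]
  simp [mul_comm]

lemma inter_K_of_half (hv : IsRootFrame v) {A : Finset (Fin 8)} {w : Pic}
    (hw : 2 • w = ∑ i ∈ A, v i) : inter w K = 0 := by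
  have h := hv.inter_sum_K A
  rw [← hw, two_nsmul, inter_add_left] at h
  linarith

lemma two_mul_inter_half (hv : IsRootFrame v) {A B : Finset (Fin 8)} {w x : Pic}
    (hw : 2 • w = ∑ i ∈ A, v i) (hx : 2 • x = ∑ i ∈ B, v i) :
    2 * inter w x = -(A ∩ B).card := by
  have h := hv.inter_sum_sum A B
  rw [← hw, ← hx, inter_eq_interForm] at h
  simp only [two_nsmul, map_add, LinearMap.add_apply] at h
  rw [inter_eq_interForm]
  linarith

lemma even_card_inter (hv : IsRootFrame v) {A B : Finset (Fin 8)} (hA : IsHalvable v A)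
    (hB : IsHalvable v B) : Even (A ∩ B).card := by
  obtain ⟨w, hw⟩ := hA
  obtain ⟨x, hx⟩ := hB
  have h := hv.two_mul_inter_half hw hx
  rw [Nat.even_iff]
  omega

lemma four_dvd_card (hv : IsRootFrame v) {A : Finset (Fin 8)} (hA : IsHalvable v A) :
    4 ∣ A.card := by
  obtain ⟨w, hw⟩ := hA
  have h := hv.two_mul_inter_half hw hw
  obtain ⟨k, hk⟩ := even_inter_self_of_inter_K (hv.inter_K_of_half hw)
  rw [Finset.inter_self] at h
  omega

end IsRootFrame

/-- The linear map over `𝔽₂` taking coefficients to the reduction of the corresponding combination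
of the classes `v i`. -/
def reductionMap (v : Fin 8 → Pic) : (Fin 8 → ZMod 2) →ₗ[ZMod 2] (Fin 9 → ZMod 2) :=
  Fintype.linearCombination (ZMod 2) fun i j => (v i j : ZMod 2)

/-- The binary code of halvable subsets. -/
def code (v : Fin 8 → Pic) : Submodule (ZMod 2) (Fin 8 → ZMod 2) :=
  LinearMap.ker (reductionMap v)

/-- Subsets of `Fin n` correspond to binary words. -/
def wordEquiv (n : ℕ) : (Fin n → ZMod 2) ≃ Finset (Fin n) where
  toFun c := {i | c i = 1}
  invFun A i := if i ∈ A then 1 else 0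
  left_inv c := by
    funext i
    generalize hc : c i = a
    revert a
    simp only [Finset.mem_filter_univ]
    intro a ha
    rw [ha]
    clear ha
    revert a
    decide
  right_inv A := by
    ext i
    simp

lemma mem_code_iff (v : Fin 8 → Pic) (c : Fin 8 → ZMod 2) :
    c ∈ code v ↔ IsHalvable v (wordEquiv 8 c) := by
  obtain ⟨A, rfl⟩ := (wordEquiv 8).symm.surjective c
  rw [Equiv.apply_symm_apply]
  have hj (j : Fin 9) : reductionMap v ((wordEquiv 8).symm A) j =
      (((∑ i ∈ A, v i) j : ℤ) : ZMod 2) := by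
    simp [reductionMap, Fintype.linearCombination_apply, wordEquiv, ite_apply]
  rw [code, LinearMap.mem_ker, funext_iff]
  simp only [hj, Pi.zero_apply, ZMod.intCast_zmod_eq_zero_iff_dvd]
  constructor
  · intro h
    choose w hw using h
    exact ⟨w, funext fun j => by simpa using (hw j).symm⟩
  · rintro ⟨w, hw⟩ j
    exact ⟨w j, by rw [← hw]; simp⟩

/-- The standard dot product as a bilinear form. -/
abbrev dotForm (n : ℕ) : LinearMap.BilinForm (ZMod 2) (Fin n → ZMod 2) :=
  Matrix.toBilin' 1

lemma dotForm_apply {n : ℕ} (x y : Fin n → ZMod 2) : dotForm n x y = x ⬝ᵥ y := by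
  simp [dotForm, Matrix.toBilin'_apply']

lemma finrank_orthogonal_dotForm {n : ℕ} (W : Submodule (ZMod 2) (Fin n → ZMod 2)) :
    Module.finrank (ZMod 2) ((dotForm n).orthogonal W) = n - Module.finrank (ZMod 2) W := by
  have h : (dotForm n).Nondegenerate :=
    LinearMap.BilinForm.nondegenerate_toBilin'_of_det_ne_zero' _ (by simp)
  rw [LinearMap.BilinForm.finrank_orthogonal h, Module.finrank_fin_fun]

lemma two_mul_finrank_le_of_le_orthogonal {n : ℕ} {W : Submodule (ZMod 2) (Fin n → ZMod 2)}
    (hW : W ≤ (dotForm n).orthogonal W) : 2 * Module.finrank (ZMod 2) W ≤ n := by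
  have h1 := Submodule.finrank_mono hW
  have h2 := Submodule.finrank_le W
  rw [finrank_orthogonal_dotForm] at h1
  rw [Module.finrank_fin_fun] at h2
  omega

lemma dotProduct_eq_card (c d : Fin 8 → ZMod 2) :
    c ⬝ᵥ d = ((wordEquiv 8 c ∩ wordEquiv 8 d).card : ZMod 2) := by
  obtain ⟨A, rfl⟩ := (wordEquiv 8).symm.surjective c
  obtain ⟨B, rfl⟩ := (wordEquiv 8).symm.surjective d
  rw [Equiv.apply_symm_apply, Equiv.apply_symm_apply]
  simp [wordEquiv, dotProduct, ← ite_and, ← Finset.mem_inter, Finset.inter_comm]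

namespace IsRootFrame

variable {v : Fin 8 → Pic}

lemma four_le_finrank_code (hv : IsRootFrame v) : 4 ≤ Module.finrank (ZMod 2) (code v) := by
  have hW : LinearMap.range (reductionMap v) ≤
      (dotForm 9).orthogonal (LinearMap.range (reductionMap v)) := by
    rintro _ ⟨c, rfl⟩ _ ⟨d, rfl⟩
    have h (i j : Fin 8) :
        dotForm 9 (fun k => (v i k : ZMod 2)) (fun k => (v j k : ZMod 2)) = 0 := by
      rw [dotForm_apply, ← intCast_inter, hv.inter_inter]
      split_ifs <;> decide
    simp only [reductionMap, Fintype.linearCombination_apply, map_sum, map_smul,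
      LinearMap.sum_apply, LinearMap.smul_apply, h, smul_zero, Finset.sum_const_zero]
  have h1 := two_mul_finrank_le_of_le_orthogonal hW
  have h2 := LinearMap.finrank_range_add_finrank_ker (reductionMap v)
  rw [Module.finrank_fin_fun] at h2
  rw [code]
  omega

lemma code_le_orthogonal (hv : IsRootFrame v) : code v ≤ (dotForm 8).orthogonal (code v) := by
  intro c hc d hd
  rw [mem_code_iff] at hc hd
  rw [dotForm_apply, dotProduct_eq_card,
    ZMod.natCast_eq_zero_iff_even]
  exact hv.even_card_inter hd hc

lemma finrank_code (hv : IsRootFrame v) : Module.finrank (ZMod 2) (code v) = 4 := by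
  have h1 := two_mul_finrank_le_of_le_orthogonal hv.code_le_orthogonal
  have h2 := hv.four_le_finrank_code
  omega

lemma code_eq_orthogonal (hv : IsRootFrame v) : code v = (dotForm 8).orthogonal (code v) := by
  refine Submodule.eq_of_le_of_finrank_le hv.code_le_orthogonal ?_
  rw [finrank_orthogonal_dotForm, hv.finrank_code]

lemma isHalvable_univ (hv : IsRootFrame v) : IsHalvable v Finset.univ := by
  have h1 : wordEquiv 8 1 = Finset.univ := by simp [wordEquiv]
  rw [← h1, ← mem_code_iff, hv.code_eq_orthogonal]
  intro d hd
  rw [mem_code_iff] at hd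
  rw [dotForm_apply, dotProduct_eq_card, h1,
    ZMod.natCast_eq_zero_iff_even, Finset.inter_univ]
  simpa using hv.even_card_inter hd hd

lemma isHalvable_compl (hv : IsRootFrame v) {A : Finset (Fin 8)} (hA : IsHalvable v A) :
    IsHalvable v Aᶜ := by
  obtain ⟨w, hw⟩ := hA
  obtain ⟨x, hx⟩ := hv.isHalvable_univ
  refine ⟨x - w, ?_⟩
  rw [smul_sub, hw, hx, ← Finset.sum_add_sum_compl A v, add_sub_cancel_left]

open Classical in
lemma card_isHalvable (hv : IsRootFrame v) :
    (Finset.univ.filter (IsHalvable v)).card = 16 := by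
  have h := Module.card_eq_pow_finrank (K := ZMod 2) (V := code v)
  rw [hv.finrank_code, ZMod.card] at h
  rw [← Fintype.card_subtype, ← Fintype.card_congr ((wordEquiv 8).subtypeEquiv (mem_code_iff v))]
  exact h

open Classical in
lemma card_isHalvable_zero_mem (hv : IsRootFrame v) :
    (Finset.univ.filter fun A => IsHalvable v A ∧ 0 ∈ A).card = 8 := by
  have h : (Finset.univ.filter fun A => IsHalvable v A ∧ 0 ∈ A).card =
      (Finset.univ.filter fun A => IsHalvable v A ∧ 0 ∉ A).card := by
    refine Finset.card_bij' (fun A _ => Aᶜ) (fun A _ => Aᶜ) ?_ ?_ ?_ ?_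
    · simp +contextual [hv.isHalvable_compl]
    · simp +contextual [hv.isHalvable_compl]
    · simp
    · simp
  have h16 := hv.card_isHalvable
  rw [← Finset.card_filter_add_card_filter_not (fun A => 0 ∈ A), Finset.filter_filter,
    Finset.filter_filter] at h16
  omega

lemma card_eq_four (hv : IsRootFrame v) {A : Finset (Fin 8)} (hA : IsHalvable v A)
    (h0 : A.Nonempty) (h1 : A ≠ Finset.univ) : A.card = 4 := by
  have hd := hv.four_dvd_card hA
  have hpos := h0.card_pos
  have hlt := (Finset.card_lt_iff_ne_univ A).mpr h1
  rw [Fintype.card_fin] at hlt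
  omega

open Classical in
lemma card_isHalvable_zero_mem_card_eq_four (hv : IsRootFrame v) :
    (Finset.univ.filter fun A => IsHalvable v A ∧ A.card = 4 ∧ 0 ∈ A).card = 7 := by
  have h : (Finset.univ.filter fun A => IsHalvable v A ∧ A.card = 4 ∧ 0 ∈ A) =
      (Finset.univ.filter fun A => IsHalvable v A ∧ 0 ∈ A).erase Finset.univ := by
    ext A
    simp only [Finset.mem_filter_univ, Finset.mem_erase]
    constructor
    · rintro ⟨hA, hc, h0⟩
      refine ⟨?_, hA, h0⟩
      rintro rfl
      simp at hc
    · rintro ⟨hne, hA, h0⟩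
      exact ⟨hA, hv.card_eq_four hA ⟨0, h0⟩ hne, h0⟩
  rw [h, Finset.card_erase_of_mem, hv.card_isHalvable_zero_mem]
  simp [hv.isHalvable_univ]

end IsRootFrame

lemma isRootFrame_add_K {l : Fin 8 → Pic} (hline : ∀ i, IsLine (l i))
    (hint : ∀ i j, i ≠ j → inter (l i) (l j) = 1) : IsRootFrame fun i => l i + K where
  inter_K i := by
    rw [inter_add_left, (hline i).2, inter_eq_interForm, interForm_K_K]
    rfl
  inter_inter i j := by
    have hi := (hline i).2
    have hj := (hline j).2
    rw [inter_eq_interForm] at hi hj ⊢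
    simp only [map_add, LinearMap.add_apply, interForm_K_K, interForm_comm K, hi, hj]
    rw [← inter_eq_interForm]
    split_ifs with h
    · rw [h, (hline j).1]
      rfl
    · rw [hint i j h]
      rfl

/-- Four pairwise meeting lines are cornered exactly when the sum of the associated roots is
divisible by two. -/
lemma isCornered_image_iff {l : Fin 8 → Pic} (hline : ∀ i, IsLine (l i))
    (hint : ∀ i j, i ≠ j → inter (l i) (l j) = 1) {A : Finset (Fin 8)} (hA : A.card = 4) :
    IsCornered (A.image l) ↔ IsHalvable (fun i => l i + K) A := by
  have hv := isRootFrame_add_K hline hint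
  constructor
  · rintro ⟨m, ⟨hmm, hmK⟩, hm⟩
    refine ⟨m + K, sub_eq_zero.mp ?_⟩
    have hK := hv.inter_sum_K A
    have hS := hv.inter_sum_sum A A
    have hmS : inter m (∑ i ∈ A, (l i + K)) = -4 := by
      rw [inter_eq_interForm, map_sum, Finset.sum_congr rfl (g := fun _ => -1), Finset.sum_const,
        hA]
      · rfl
      · intro i hi
        rw [map_add, ← inter_eq_interForm, ← inter_eq_interForm,
          hm _ (Finset.mem_image_of_mem l hi), hmK, zero_add]
    rw [Finset.inter_self, hA] at hS
    generalize (∑ i ∈ A, (l i + K)) = s at *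
    rw [inter_eq_interForm] at hmm hmK hK hS hmS
    apply eq_zero_of_inter_K_eq_zero <;>
    · rw [inter_eq_interForm]
      simp only [map_add, map_sub, map_nsmul, LinearMap.sub_apply, LinearMap.add_apply,
        LinearMap.smul_apply, interForm_comm K m, interForm_comm s m, interForm_comm K s,
        interForm_K_K, hmm, hmK, hK, hS, hmS]
      norm_num
  · rintro ⟨w, hw⟩
    have hwK := hv.inter_K_of_half hw
    have hww := hv.two_mul_inter_half hw hw
    rw [Finset.inter_self, hA] at hww
    refine ⟨w - K, ⟨?_, ?_⟩, ?_⟩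
    · rw [inter_eq_interForm] at *
      simp only [map_sub, LinearMap.sub_apply, interForm_comm K w, interForm_K_K, hwK]
      push_cast at hww
      linarith
    · rw [inter_eq_interForm] at *
      simp only [map_sub, LinearMap.sub_apply, interForm_K_K, hwK]
      norm_num
    · intro x hx
      obtain ⟨i, hi, rfl⟩ := Finset.mem_image.mp hx
      have h := hv.inter_sum_left A i
      rw [← hw, if_pos hi] at h
      have hiK := (hline i).2
      rw [inter_eq_interForm] at *
      simp only [two_nsmul, map_sub, map_add, LinearMap.sub_apply, LinearMap.add_apply,
        interForm_comm K (l i), hwK, hiK] at h ⊢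
      linarith

lemma image_univ_sdiff_image {l : Fin 8 → Pic} (hinj : Function.Injective l)
    (A : Finset (Fin 8)) : Finset.image l Finset.univ \ A.image l = Aᶜ.image l := by
  rw [← Finset.image_sdiff _ _ hinj, Finset.compl_eq_univ_sdiff]

lemma inter_sum_K_of_isLine {ι : Type*} {l : ι → Pic} (hline : ∀ i, IsLine (l i))
    (A : Finset ι) : inter (∑ i ∈ A, l i) K = -A.card := by
  simp only [inter_eq_interForm, map_sum, LinearMap.sum_apply]
  simp [← inter_eq_interForm, (hline _).2]

theorem A7_center_is_ruling_with_seven_partitions (l : Fin 8 → Pic)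
    (hinj : Function.Injective l)
    (hline : ∀ i, IsLine (l i))
    (hint : ∀ i j, i ≠ j → inter (l i) (l j) = 1) :
    -- (a) the class `f` with `2f = D + 4K` is a ruling
    (∀ f : Pic, 2 • f = (∑ i, l i) + 4 • K → inter f f = 0 ∧ inter f K = -2) ∧
    -- (b) the complement of a cornered 4-subset is cornered, and the two associated
    -- lines `K + D₁/2`, `K + D₂/2` intersect in `1` and sum to `f`
    (∀ T : Finset Pic, T ⊆ Finset.image l Finset.univ → T.card = 4 → IsCornered T →
      IsCornered (Finset.image l Finset.univ \ T) ∧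
      ∀ la lb f : Pic, 2 • la = 2 • K + ∑ x ∈ T, x →
        2 • lb = 2 • K + ∑ x ∈ Finset.image l Finset.univ \ T, x →
        2 • f = (∑ i, l i) + 4 • K →
        inter la lb = 1 ∧ la + lb = f) ∧
    -- (c) there are exactly seven unordered partitions into complementary cornered 4-subsets
    Set.ncard {P : Finset (Finset Pic) | ∃ T : Finset Pic,
        T ⊆ Finset.image l Finset.univ ∧ T.card = 4 ∧ IsCornered T ∧
        IsCornered (Finset.image l Finset.univ \ T) ∧
        P = {T, Finset.image l Finset.univ \ T}} = 7 := by
  classical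
  have hv := isRootFrame_add_K hline hint
  have hcorn {A : Finset (Fin 8)} (hA : A.card = 4) := isCornered_image_iff hline hint hA
  have hcompl {A : Finset (Fin 8)} (hA : A.card = 4) : Aᶜ.card = 4 := by
    rw [Finset.card_compl, hA, Fintype.card_fin]
  refine ⟨fun f hf => ?_, fun T hT hTc hTcorn => ?_, ?_⟩
  · have hx : 2 • (f + 2 • K) = ∑ i, (l i + K) := by
      rw [smul_add, hf, Finset.sum_add_distrib, Finset.sum_const, Finset.card_univ,
        Fintype.card_fin]
      module
    have hxK := hv.inter_K_of_half hx
    have hxx := hv.two_mul_inter_half hx hx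
    rw [Finset.inter_self, Finset.card_univ, Fintype.card_fin] at hxx
    rw [inter_eq_interForm] at hxK hxx
    rw [inter_eq_interForm, inter_eq_interForm]
    simp only [two_nsmul, map_add, LinearMap.add_apply, interForm_comm K f, interForm_K_K] at hxK hxx
    push_cast at hxK hxx
    constructor <;> linarith
  · obtain ⟨A, -, rfl⟩ := Finset.subset_image_iff.mp hT
    rw [Finset.card_image_of_injective _ hinj] at hTc
    rw [image_univ_sdiff_image hinj, hcorn (hcompl hTc)]
    refine ⟨hv.isHalvable_compl ((hcorn hTc).mp hTcorn), fun la lb f hla hlb hf => ?_⟩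
    rw [Finset.sum_image hinj.injOn] at hla hlb
    constructor
    · have hs (B : Finset (Fin 8)) (hB : B.card = 4) (x : Pic) (hx : 2 • x = 2 • K + ∑ i ∈ B, l i) :
          2 • (x + K) = ∑ i ∈ B, (l i + K) := by
        rw [smul_add, hx, Finset.sum_add_distrib, Finset.sum_const, hB]
        module
      have ha := hs A hTc la hla
      have hb := hs Aᶜ (hcompl hTc) lb hlb
      have haK := hv.inter_K_of_half ha
      have hbK := hv.inter_K_of_half hb
      have hab := hv.two_mul_inter_half ha hb
      rw [Finset.inter_compl, Finset.card_empty] at hab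
      rw [inter_eq_interForm] at *
      simp only [map_add, LinearMap.add_apply, interForm_comm K lb, interForm_K_K] at haK hbK hab
      push_cast at hab
      linarith
    · have h2 : 2 • (la + lb) = 2 • f := by
        rw [smul_add, hla, hlb, hf, ← Finset.sum_add_sum_compl A l]
        module
      exact smul_right_injective Pic two_ne_zero h2
  · have himg := Finset.image_injective hinj
    rw [← hv.card_isHalvable_zero_mem_card_eq_four,
      ← Finset.card_image_of_injOn (f := fun A => ({A.image l, Aᶜ.image l} : Finset (Finset Pic))),
      ← Set.ncard_coe_finset]
    · congr 1
      ext P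
      simp only [Set.mem_ofPred_eq, Finset.coe_image, Finset.coe_filter, Finset.mem_univ, true_and,
        Set.mem_image]
      constructor
      · rintro ⟨T, hT, hTc, hTcorn, -, rfl⟩
        obtain ⟨A, -, rfl⟩ := Finset.subset_image_iff.mp hT
        rw [Finset.card_image_of_injective _ hinj] at hTc
        rw [hcorn hTc] at hTcorn
        rw [image_univ_sdiff_image hinj]
        by_cases h0 : 0 ∈ A
        · exact ⟨A, ⟨hTcorn, hTc, h0⟩, rfl⟩
        · refine ⟨Aᶜ, ⟨hv.isHalvable_compl hTcorn, hcompl hTc, Finset.mem_compl.mpr h0⟩, ?_⟩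
          rw [compl_compl, Finset.pair_comm]
      · rintro ⟨A, ⟨hA, hAc, -⟩, rfl⟩
        refine ⟨A.image l, Finset.image_subset_image (Finset.subset_univ A), ?_, ?_, ?_, ?_⟩
        · rwa [Finset.card_image_of_injective _ hinj]
        · exact (hcorn hAc).mpr hA
        · rw [image_univ_sdiff_image hinj]
          exact (hcorn (hcompl hAc)).mpr (hv.isHalvable_compl hA)
        · rw [image_univ_sdiff_image hinj]
    · intro A hA B hB hAB
      simp only [Finset.coe_filter, Finset.mem_univ, true_and, Set.mem_ofPred_eq] at hA hB
      have hmem : A.image l ∈ ({B.image l, Bᶜ.image l} : Finset (Finset Pic)) := by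
        rw [← show ({A.image l, Aᶜ.image l} : Finset (Finset Pic)) =
          {B.image l, Bᶜ.image l} from hAB]
        exact Finset.mem_insert_self _ _
      rw [Finset.mem_insert, Finset.mem_singleton] at hmem
      rcases hmem with h | h
      · exact himg h
      · have := himg h ▸ hA.2.2
        exact absurd hB.2.2 (Finset.mem_compl.mp this)

end DelPezzo
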